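/- For all nonnegative integers k and n, the number of partitions λ with λ_1 = k and λ_1 + λ_3 + λ_5 + ⋯ = n equals the number of ordered pairs (α, β) of partitions with ℓ(α) + ℓ(β) = k and |α| + |β| = n. (This is the coefficient-wise form of the Bridges–Uncu identity ∑_{λ∈𝒫} z^{λ_1} q^{λ_1+λ_3+λ_5+⋯} = 1/(qz;q)_∞².) -/

import Mathlib

/-- A partition: a weakly decreasing sequence of naturals with finite support.
`p.parts i` is the `(i+1)`-st part, i.e. parts are 0-indexed (`λ_1 = p.parts 0`). -/
structure Ptn where
  parts : ℕ → ℕ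
  antitone' : ∀ ⦃i j : ℕ⦄, i ≤ j → parts j ≤ parts i
  finite_support' : (Function.support parts).Finite

namespace Ptn

/-- The size `|λ|` of a partition: the sum of all its parts. -/
noncomputable def size (p : Ptn) : ℕ := ∑ᶠ i, p.parts i

/-- The number of (nonzero) parts `ℓ(λ)`. -/
noncomputable def length (p : Ptn) : ℕ := (Function.support p.parts).ncard

/-- A partition has distinct parts if no nonzero value is repeated. -/
def Distinct (p : Ptn) : Prop := ∀ i : ℕ, p.parts (i + 1) ≠ 0 → p.parts (i + 1) < p.parts i

/-- A partition has odd parts if every part is odd. -/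
def OddParts (p : Ptn) : Prop := ∀ i : ℕ, p.parts i ≠ 0 → Odd (p.parts i)

end Ptn

namespace Ptn

theorem ext_parts {p q : Ptn} (h : ∀ i, p.parts i = q.parts i) : p = q := by
  obtain ⟨f, _, _⟩ := p
  obtain ⟨g, _, _⟩ := q
  obtain rfl : f = g := funext h
  rfl

theorem exists_parts_eq_zero (p : Ptn) : ∃ N, ∀ i, N ≤ i → p.parts i = 0 := by
  obtain ⟨N, hN⟩ := p.finite_support'.bddAbove
  refine ⟨N + 1, fun i hi => ?_⟩
  by_contra h
  have := hN (Function.mem_support.2 h)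
  omega

/-- Build a partition from a sequence with weakly decreasing consecutive terms that vanishes from
some index on. -/
def ofStep (f : ℕ → ℕ) (hf : ∀ i, f (i + 1) ≤ f i) (h0 : ∃ N, ∀ i, N ≤ i → f i = 0) : Ptn where
  parts := f
  antitone' := antitone_nat_of_succ_le hf
  finite_support' := by
    obtain ⟨N, hN⟩ := h0
    refine (Set.finite_Iio N).subset fun i hi => ?_
    by_contra h
    exact hi (hN i (not_lt.1 h))

theorem exists_parts_le (p : Ptn) (j : ℕ) : ∃ i, p.parts i ≤ j := by
  obtain ⟨N, hN⟩ := p.exists_parts_eq_zero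
  exact ⟨N, by simp [hN N le_rfl]⟩

theorem lt_find_iff (p : Ptn) (i j : ℕ) :
    i < Nat.find (p.exists_parts_le j) ↔ j < p.parts i := by
  rw [Nat.lt_find_iff]
  refine ⟨fun h => not_le.1 (h i le_rfl), fun h m hm => ?_⟩
  exact not_le.2 (h.trans_le (p.antitone' hm))

/-- The conjugate partition. -/
def conj (p : Ptn) : Ptn :=
  ofStep (fun j => Nat.find (p.exists_parts_le j))
    (fun j => Nat.find_mono fun _ h => h.trans j.le_succ)
    ⟨p.parts 0, fun j hj => by simpa using hj⟩

theorem lt_parts_conj_iff (p : Ptn) (i j : ℕ) : i < p.conj.parts j ↔ j < p.parts i :=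
  p.lt_find_iff i j

theorem conj_conj (p : Ptn) : p.conj.conj = p :=
  ext_parts fun i => eq_of_forall_lt_iff fun j => by rw [lt_parts_conj_iff, lt_parts_conj_iff]

theorem length_eq_parts_conj_zero (p : Ptn) : p.length = p.conj.parts 0 := by
  have : Function.support p.parts = (Finset.range (p.conj.parts 0) : Set ℕ) := by
    ext i
    simp [lt_parts_conj_iff, Nat.pos_iff_ne_zero]
  rw [length, this, Set.ncard_coe_finset, Finset.card_range]

theorem size_eq_sum_range (p : Ptn) {N : ℕ} (hN : ∀ i, N ≤ i → p.parts i = 0) :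
    p.size = ∑ i ∈ Finset.range N, p.parts i := by
  refine finsum_eq_sum_of_support_subset _ fun i hi => ?_
  by_contra h
  exact hi (hN i (by simpa using h))

theorem size_conj (p : Ptn) : p.conj.size = p.size := by
  obtain ⟨N, hN⟩ := p.exists_parts_eq_zero
  have hK : ∀ j, p.parts 0 ≤ j → p.conj.parts j = 0 := fun j hj => by
    by_contra h
    have := (p.lt_parts_conj_iff 0 j).1 (Nat.pos_of_ne_zero h)
    omega
  rw [size_eq_sum_range _ hN, size_eq_sum_range _ hK]
  have h1 : ∀ i, p.parts i = ((Finset.range (p.parts 0)).filter (· < p.parts i)).card := by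
    intro i
    have : (Finset.range (p.parts 0)).filter (· < p.parts i) = Finset.range (p.parts i) := by
      ext j
      have := p.antitone' (Nat.zero_le i)
      simp only [Finset.mem_filter, Finset.mem_range]
      omega
    rw [this, Finset.card_range]
  have h2 : ∀ j, p.conj.parts j = ((Finset.range N).filter (j < p.parts ·)).card := by
    intro j
    have : (Finset.range N).filter (j < p.parts ·) = Finset.range (p.conj.parts j) := by
      ext i
      simp only [Finset.mem_filter, Finset.mem_range, lt_parts_conj_iff]
      refine ⟨And.right, fun h => ⟨?_, h⟩⟩
      by_contra hi
      simp [hN i (not_lt.1 hi)] at h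
    rw [this, Finset.card_range]
  rw [Finset.sum_congr rfl fun i _ => h1 i, Finset.sum_congr rfl fun j _ => h2 j]
  exact (Finset.sum_card_bipartiteAbove_eq_sum_card_bipartiteBelow
    (fun i j => j < p.parts i)).symm

/-- The partition with `parts (2 * i) = a i + b i` and `parts (2 * i + 1) = a (i + 1) + b i`. -/
def interlace (a b : Ptn) : Ptn :=
  ofStep (fun i => a.parts ((i + 1) / 2) + b.parts (i / 2))
    (fun i => add_le_add (a.antitone' (by omega)) (b.antitone' (by omega)))
    (by
      obtain ⟨M, hM⟩ := a.exists_parts_eq_zero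
      obtain ⟨N, hN⟩ := b.exists_parts_eq_zero
      exact ⟨2 * (M + N), fun i hi => by rw [hM _ (by omega), hN _ (by omega)]⟩)

theorem parts_interlace (a b : Ptn) (i : ℕ) :
    (interlace a b).parts i = a.parts ((i + 1) / 2) + b.parts (i / 2) := rfl

theorem parts_interlace_even (a b : Ptn) (i : ℕ) :
    (interlace a b).parts (2 * i) = a.parts i + b.parts i := by
  rw [parts_interlace, show (2 * i + 1) / 2 = i by omega, show 2 * i / 2 = i by omega]

theorem parts_interlace_odd (a b : Ptn) (i : ℕ) :
    (interlace a b).parts (2 * i + 1) = a.parts (i + 1) + b.parts i := by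
  rw [parts_interlace, show (2 * i + 1 + 1) / 2 = i + 1 by omega,
    show (2 * i + 1) / 2 = i by omega]

theorem interlace_injective : Function.Injective fun q : Ptn × Ptn => interlace q.1 q.2 := by
  rintro ⟨a, b⟩ ⟨c, d⟩ h
  have he (i : ℕ) : a.parts i + b.parts i = c.parts i + d.parts i := by
    simpa only [parts_interlace_even] using congrArg (fun p => p.parts (2 * i)) h
  have ho (i : ℕ) : a.parts (i + 1) + b.parts i = c.parts (i + 1) + d.parts i := by
    simpa only [parts_interlace_odd] using congrArg (fun p => p.parts (2 * i + 1)) h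
  obtain ⟨M, hM⟩ := a.exists_parts_eq_zero
  obtain ⟨N, hN⟩ := c.exists_parts_eq_zero
  have key (t : ℕ) : ∀ i, M + N ≤ i + t → a.parts i = c.parts i := by
    induction t with
    | zero => exact fun i hi => by rw [hM _ (by omega), hN _ (by omega)]
    | succ t ih =>
      intro i hi
      have := ih (i + 1) (by omega)
      have := he i
      have := ho i
      omega
  have hac (i : ℕ) : a.parts i = c.parts i := key (M + N) i (by omega)
  have hbd (i : ℕ) : b.parts i = d.parts i := by
    have := he i
    have := hac i
    omega
  rw [ext_parts hac, ext_parts hbd]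

/-- The partition whose consecutive differences are the values `d i` for `i < N`. -/
def ofDiff (d : ℕ → ℕ) (N : ℕ) : Ptn :=
  ofStep (fun i => ∑ j ∈ Finset.Ico i N, d j)
    (fun i => Finset.sum_le_sum_of_subset (Finset.Ico_subset_Ico_left i.le_succ))
    ⟨N, fun i hi => by simp [hi]⟩

theorem parts_ofDiff_of_le (d : ℕ → ℕ) {N i : ℕ} (h : N ≤ i) : (ofDiff d N).parts i = 0 := by
  simp [ofDiff, ofStep, h]

theorem parts_ofDiff_of_lt (d : ℕ → ℕ) {N i : ℕ} (h : i < N) :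
    (ofDiff d N).parts i = d i + (ofDiff d N).parts (i + 1) :=
  Finset.sum_eq_sum_Ico_succ_bot h d

theorem interlace_surjective : Function.Surjective fun q : Ptn × Ptn => interlace q.1 q.2 := by
  intro p
  obtain ⟨N, hN⟩ := p.exists_parts_eq_zero
  let a := ofDiff (fun j => p.parts (2 * j) - p.parts (2 * j + 1)) N
  let b := ofDiff (fun j => p.parts (2 * j + 1) - p.parts (2 * j + 2)) N
  have ha0 {i : ℕ} (h : N ≤ i) : a.parts i = 0 := parts_ofDiff_of_le _ h
  have hb0 {i : ℕ} (h : N ≤ i) : b.parts i = 0 := parts_ofDiff_of_le _ h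
  have ha {i : ℕ} (h : i < N) :
      a.parts i = p.parts (2 * i) - p.parts (2 * i + 1) + a.parts (i + 1) :=
    parts_ofDiff_of_lt _ h
  have hb {i : ℕ} (h : i < N) :
      b.parts i = p.parts (2 * i + 1) - p.parts (2 * i + 2) + b.parts (i + 1) :=
    parts_ofDiff_of_lt _ h
  have h1 (i : ℕ) : p.parts (2 * i + 1) ≤ p.parts (2 * i) := p.antitone' (by omega)
  have h2 (i : ℕ) : p.parts (2 * i + 2) ≤ p.parts (2 * i + 1) := p.antitone' (by omega)
  have key (t : ℕ) : ∀ i, N ≤ i + t → a.parts i + b.parts i = p.parts (2 * i) := by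
    induction t with
    | zero => exact fun i hi => by rw [ha0 (by omega), hb0 (by omega), hN _ (by omega)]
    | succ t ih =>
      intro i hi
      obtain h | h := le_or_gt N i
      · rw [ha0 h, hb0 h, hN _ (by omega)]
      · have := ih (i + 1) (by omega)
        rw [show 2 * (i + 1) = 2 * i + 2 by ring] at this
        have := h1 i
        have := h2 i
        have := ha h
        have := hb h
        omega
  have he (i : ℕ) : a.parts i + b.parts i = p.parts (2 * i) := key N i (by omega)
  refine ⟨(a, b), ext_parts fun m => ?_⟩
  obtain ⟨i, rfl | rfl⟩ := m.even_or_odd'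
  · exact (parts_interlace_even a b i).trans (he i)
  · refine (parts_interlace_odd a b i).trans ?_
    obtain h | h := le_or_gt N i
    · rw [ha0 (by omega), hb0 h, hN _ (by omega)]
    · have := he i
      have := ha h
      have := h1 i
      omega

theorem finsum_parts_interlace_even (a b : Ptn) :
    ∑ᶠ i, (interlace a b).parts (2 * i) = a.size + b.size := by
  simp only [parts_interlace_even]
  exact finsum_add_distrib a.finite_support' b.finite_support'

end Ptn

/-- Coefficient-wise form of the Bridges–Uncu identity
`∑_{λ∈𝒫} z^{λ_1} q^{λ_1+λ_3+λ_5+⋯} = 1/(qz;q)_∞²`. -/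
theorem bridges_uncu_one (k n : ℕ) :
    {p : Ptn | p.parts 0 = k ∧ (∑ᶠ i : ℕ, p.parts (2 * i)) = n}.ncard
      = {q : Ptn × Ptn | q.1.length + q.2.length = k ∧ q.1.size + q.2.size = n}.ncard := by
  have hconj : Function.Involutive Ptn.conj := Ptn.conj_conj
  let F : Ptn × Ptn → Ptn := fun q => Ptn.interlace q.1.conj q.2.conj
  have hF : Function.Bijective F :=
    Function.Bijective.comp ⟨Ptn.interlace_injective, Ptn.interlace_surjective⟩
      (hconj.bijective.prodMap hconj.bijective)
  rw [← Set.ncard_preimage_of_injective_subset_range hF.injective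
    (by simp [hF.surjective.range_eq])]
  congr 1
  ext ⟨a, b⟩
  have h0 : (F (a, b)).parts 0 = a.length + b.length := by
    rw [Ptn.length_eq_parts_conj_zero, Ptn.length_eq_parts_conj_zero]
    exact Ptn.parts_interlace_even a.conj b.conj 0
  have hs : ∑ᶠ i, (F (a, b)).parts (2 * i) = a.size + b.size := by
    rw [← a.size_conj, ← b.size_conj]
    exact Ptn.finsum_parts_interlace_even a.conj b.conj
  simp only [Set.mem_preimage, Set.mem_ofPred_eq, h0, hs]
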